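/- arXiv:2402.14362 — 2 statements merged into one kernel-verified Lean document; each statement's English description precedes it below -/
import Mathlib

section
/- Let n and r₀ be positive integers with r₀ ≥ n, and fix nonpositive real numbers h_{1,1}, …, h_{n,n}. Consider the Hermitian matrix H = [h_{i,j}]_{i,j=1}^n with the given diagonal entries, with h_{j,i} = conj(h_{i,j}) for i < j, and with the strictly upper triangular entries h_{i,j} (1 ≤ i < j ≤ n) as complex integration variables. Then the integral, over the set of off-diagonal entries for which H is negative semidefinite, of (det H)^{r₀−n} with respect to Lebesgue measure ∏_{1≤i<j≤n} d(Re h_{i,j}) d(Im h_{i,j}), equals π^{n(n−1)/2} · ((r₀−1)!)^{−n} · (∏_{k=1}^n (r₀−k)!) · ∏_{j=1}^n h_{j,j}^{r₀−1}. -/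
open MeasureTheory ComplexOrder

/-- The Hermitian matrix with prescribed real diagonal `h` and strictly upper
triangular entries given by `u` (lower triangular entries are the conjugates). -/
noncomputable def hermOfUpper (n : ℕ) (h : Fin n → ℝ)
    (u : {p : Fin n × Fin n // p.1 < p.2} → ℂ) : Matrix (Fin n) (Fin n) ℂ :=
  fun i j =>
    if hij : i < j then u ⟨(i, j), hij⟩
    else if hji : j < i then (starRingEnd ℂ) (u ⟨(j, i), hji⟩)
    else (h i : ℂ)

/-- The set of positive semidefinite complex matrices is closed. -/
theorem isClosed_setOf_posSemidef {ι : Type*} [Fintype ι] :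
    IsClosed {M : Matrix ι ι ℂ | M.PosSemidef} := by
  simp only [Matrix.posSemidef_iff_dotProduct_mulVec, Matrix.IsHermitian, Set.ofPred_and,
    Set.ofPred_forall]
  refine (isClosed_eq (by fun_prop) continuous_id).inter (isClosed_iInter fun x => ?_)
  exact isClosed_le continuous_const (by fun_prop)

/-- Volume of the closed Euclidean ball of squared radius `r` in `ℂ^ι`. -/
theorem volume_sum_norm_sq_le (ι : Type*) [Fintype ι] {r : ℝ} (hr : 0 ≤ r) :
    volume {x : ι → ℂ | ∑ i, ‖x i‖ ^ 2 ≤ r} =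
      ENNReal.ofReal (Real.pi ^ Fintype.card ι * r ^ Fintype.card ι /
        (Fintype.card ι).factorial) := by
  rcases isEmpty_or_nonempty ι with hι | hι
  · simp [hr, volume_pi]
  · have key := Complex.volume_sum_rpow_le ι (p := 2) one_le_two (√r)
    have hset : {x : ι → ℂ | ∑ i, ‖x i‖ ^ 2 ≤ r} =
        {x : ι → ℂ | (∑ i, ‖x i‖ ^ (2 : ℝ)) ^ (1 / (2 : ℝ)) ≤ √r} := by
      ext x
      have : (0 : ℝ) ≤ ∑ i, ‖x i‖ ^ 2 := by positivity
      simp only [Real.rpow_two, ← Real.sqrt_eq_rpow, Set.mem_ofPred_eq]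
      rw [Real.sqrt_le_sqrt_iff hr]
    have h1 : (2 : ℝ) * (Fintype.card ι : ℝ) / 2 + 1 = (Fintype.card ι : ℝ) + 1 := by ring
    have h2 : (2 : ℝ) / 2 + 1 = ((1 : ℕ) : ℝ) + 1 := by norm_num
    rw [hset, key, h1, h2, Real.Gamma_nat_eq_factorial, Real.Gamma_nat_eq_factorial, pow_mul,
      ← ENNReal.ofReal_pow (Real.sqrt_nonneg r), Real.sq_sqrt hr, ← ENNReal.ofReal_pow hr,
      ← ENNReal.ofReal_mul (by positivity)]
    congr 1
    simp
    ring

/-- The Dirichlet-type integral of `(d - ‖v‖²)^s` over the ball `‖v‖² ≤ d` in `ℂ^ι`. -/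
theorem lintegral_ball_sub_sum_norm_sq_pow (ι : Type*) [Fintype ι] (s : ℕ) {d : ℝ} (hd : 0 ≤ d) :
    ∫⁻ v : ι → ℂ, {v : ι → ℂ | ∑ i, ‖v i‖ ^ 2 ≤ d}.indicator
        (fun v => ENNReal.ofReal ((d - ∑ i, ‖v i‖ ^ 2) ^ s)) v =
      ENNReal.ofReal (Real.pi ^ Fintype.card ι * s.factorial *
        d ^ (Fintype.card ι + s) / (Fintype.card ι + s).factorial) := by
  set m := Fintype.card ι
  have key := volume_sum_norm_sq_le (ι ⊕ Fin s) hd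
  have hS : MeasurableSet {p : (ι → ℂ) × (Fin s → ℂ) |
      ∑ i, ‖p.1 i‖ ^ 2 + ∑ i, ‖p.2 i‖ ^ 2 ≤ d} :=
    (isClosed_le (by fun_prop) continuous_const).measurableSet
  have hmp := volume_measurePreserving_sumPiEquivProdPi (fun _ : ι ⊕ Fin s => ℂ)
  have hpre : {x : ι ⊕ Fin s → ℂ | ∑ i, ‖x i‖ ^ 2 ≤ d} =
      MeasurableEquiv.sumPiEquivProdPi (fun _ : ι ⊕ Fin s => ℂ) ⁻¹'
        {p : (ι → ℂ) × (Fin s → ℂ) | ∑ i, ‖p.1 i‖ ^ 2 + ∑ i, ‖p.2 i‖ ^ 2 ≤ d} := by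
    ext x
    simp [Fintype.sum_sum_type, MeasurableEquiv.coe_sumPiEquivProdPi, Equiv.sumPiEquivProdPi]
  rw [hpre, hmp.measure_preimage hS.nullMeasurableSet, Measure.volume_eq_prod,
    Measure.prod_apply hS] at key
  have hfib : ∀ v : ι → ℂ, volume (Prod.mk v ⁻¹' {p : (ι → ℂ) × (Fin s → ℂ) |
      ∑ i, ‖p.1 i‖ ^ 2 + ∑ i, ‖p.2 i‖ ^ 2 ≤ d}) =
      ENNReal.ofReal (Real.pi ^ s / s.factorial) * {v : ι → ℂ | ∑ i, ‖v i‖ ^ 2 ≤ d}.indicator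
        (fun v => ENNReal.ofReal ((d - ∑ i, ‖v i‖ ^ 2) ^ s)) v := by
    intro v
    by_cases hv : ∑ i, ‖v i‖ ^ 2 ≤ d
    · have := volume_sum_norm_sq_le (Fin s) (sub_nonneg.2 hv)
      rw [Set.indicator_of_mem (by exact hv), ← ENNReal.ofReal_mul (by positivity)]
      simp only [Fintype.card_fin] at this
      convert this using 2
      · ext w
        simp [le_sub_iff_add_le']
      · ring
    · rw [Set.indicator_of_notMem (by exact hv), mul_zero]
      convert measure_empty (μ := volume)
      ext w
      have : 0 ≤ ∑ i, ‖w i‖ ^ 2 := by positivity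
      simp only [Set.mem_preimage, Set.mem_ofPred_eq, Set.mem_empty_iff_false, iff_false]
      linarith
  have hmeas : Measurable ({v : ι → ℂ | ∑ i, ‖v i‖ ^ 2 ≤ d}.indicator
      (fun v => ENNReal.ofReal ((d - ∑ i, ‖v i‖ ^ 2) ^ s))) :=
    Measurable.indicator (by fun_prop)
      (isClosed_le (by fun_prop) continuous_const).measurableSet
  simp_rw [hfib] at key
  rw [lintegral_const_mul _ hmeas] at key
  have hc : 0 < Real.pi ^ s / s.factorial := by positivity
  rw [← ENNReal.mul_right_inj (a := ENNReal.ofReal (Real.pi ^ s / s.factorial))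
    (by simpa using hc) ENNReal.ofReal_ne_top, key, ← ENNReal.ofReal_mul hc.le]
  congr 1
  simp only [Fintype.card_sum, Fintype.card_fin]
  change Real.pi ^ (m + s) * d ^ (m + s) / _ = _
  field_simp
  ring

/-- Change of variables for an invertible complex matrix acting on `ℂ^ι`. -/
theorem lintegral_comp_mulVec {ι : Type*} [Fintype ι] [DecidableEq ι] (B : Matrix ι ι ℂ)
    (hB : B.det ≠ 0) (f : (ι → ℂ) → ENNReal) (hf : Measurable f) :
    ∫⁻ v, f v = ENNReal.ofReal (Complex.normSq B.det) * ∫⁻ w, f (B.mulVec w) := by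
  set L : (ι → ℂ) →ₗ[ℝ] (ι → ℂ) := (Matrix.toLin' B).restrictScalars ℝ
  have hdet : LinearMap.det L = Complex.normSq B.det := by
    rw [LinearMap.det_restrictScalars, LinearMap.det_toLin', Algebra.norm_complex_apply]
  have hpos : 0 < Complex.normSq B.det := Complex.normSq_pos.2 hB
  have hmap := Measure.map_linearMap_addHaar_eq_smul_addHaar
    (volume : Measure (ι → ℂ)) (f := L) (by rw [hdet]; exact hpos.ne')
  have hL : Measurable L := L.continuous_of_finiteDimensional.measurable
  have h := lintegral_map (μ := volume) hf hL
  rw [hmap, lintegral_smul_measure, hdet, abs_of_pos (inv_pos.2 hpos), smul_eq_mul] at h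
  change _ = _ * ∫⁻ w, f (L w)
  rw [← h, ← mul_assoc, ← ENNReal.ofReal_mul hpos.le, mul_inv_cancel₀ hpos.ne', ENNReal.ofReal_one,
    one_mul]

/-- The Hermitian matrix obtained from `A` by adding a last column `v`, a last row `vᴴ` and the
corner entry `d`. -/
def borderedMatrix {ι : Type*} (A : Matrix ι ι ℂ) (v : ι → ℂ) (d : ℝ) :
    Matrix (ι ⊕ Fin 1) (ι ⊕ Fin 1) ℂ :=
  Matrix.fromBlocks A (Matrix.replicateCol (Fin 1) v)
    (Matrix.replicateCol (Fin 1) v).conjTranspose (Matrix.of fun _ _ => (d : ℂ))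

/-- The `s`-th power of the determinant, cut off outside the positive semidefinite cone. -/
noncomputable def detPowWeight {ι : Type*} [Fintype ι] [DecidableEq ι] (s : ℕ)
    (M : Matrix ι ι ℂ) : ENNReal :=
  {M : Matrix ι ι ℂ | M.PosSemidef}.indicator (fun M => ENNReal.ofReal (M.det.re ^ s)) M

theorem detPowWeight_of_posSemidef {ι : Type*} [Fintype ι] [DecidableEq ι] (s : ℕ)
    {M : Matrix ι ι ℂ} (hM : M.PosSemidef) :
    detPowWeight s M = ENNReal.ofReal (M.det.re ^ s) :=
  Set.indicator_of_mem (s := {M : Matrix ι ι ℂ | M.PosSemidef}) hM _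

theorem detPowWeight_of_not_posSemidef {ι : Type*} [Fintype ι] [DecidableEq ι] (s : ℕ)
    {M : Matrix ι ι ℂ} (hM : ¬ M.PosSemidef) : detPowWeight s M = 0 :=
  Set.indicator_of_notMem (s := {M : Matrix ι ι ℂ | M.PosSemidef}) hM _

theorem measurable_detPowWeight_comp {ι X : Type*} [Fintype ι] [DecidableEq ι]
    [TopologicalSpace X] [MeasurableSpace X] [BorelSpace X] (s : ℕ) {M : X → Matrix ι ι ℂ}
    (hM : Continuous M) : Measurable fun x => detPowWeight s (M x) := by
  have hS : MeasurableSet {x | (M x).PosSemidef} :=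
    (isClosed_setOf_posSemidef.preimage hM).measurableSet
  have hc : Continuous fun x => (M x).det := hM.matrix_det
  have hf : Measurable fun x => ENNReal.ofReal ((M x).det.re ^ s) :=
    Measurable.ennreal_ofReal ((Complex.continuous_re.comp hc).pow s).measurable
  exact hf.indicator hS

theorem detPowWeight_submatrix_equiv {ι κ : Type*} [Fintype ι] [DecidableEq ι] [Fintype κ]
    [DecidableEq κ] (s : ℕ) (M : Matrix ι ι ℂ) (e : κ ≃ ι) :
    detPowWeight s (M.submatrix e e) = detPowWeight s M := by
  by_cases hM : M.PosSemidef
  · rw [detPowWeight_of_posSemidef s hM, detPowWeight_of_posSemidef s (hM.submatrix e),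
      Matrix.det_submatrix_equiv_self]
  · rw [detPowWeight_of_not_posSemidef s hM, detPowWeight_of_not_posSemidef s
      (mt (Matrix.posSemidef_submatrix_equiv e).1 hM)]

theorem continuous_borderedMatrix {ι X : Type*} [TopologicalSpace X] {A : X → Matrix ι ι ℂ}
    {v : X → ι → ℂ} (hA : Continuous A) (hv : Continuous v) (d : ℝ) :
    Continuous fun x => borderedMatrix (A x) (v x) d := by
  have hcol : Continuous fun x => Matrix.replicateCol (Fin 1) (v x) :=
    continuous_matrix fun i _ => (continuous_apply i).comp hv
  exact hA.matrix_fromBlocks hcol hcol.matrix_conjTranspose continuous_const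

theorem posSemidef_of_borderedMatrix {ι : Type*} {A : Matrix ι ι ℂ} {v : ι → ℂ} {d : ℝ}
    (h : (borderedMatrix A v d).PosSemidef) : A.PosSemidef :=
  h.submatrix Sum.inl

theorem dotProduct_eq_zero_of_borderedMatrix {ι : Type*} [Fintype ι] [DecidableEq ι]
    {A : Matrix ι ι ℂ} {v : ι → ℂ} {d : ℝ} (h : (borderedMatrix A v d).PosSemidef) {x : ι → ℂ}
    (hx : A.mulVec x = 0) : dotProduct (star v) x = 0 := by
  have h0 : (borderedMatrix A v d).mulVec (Sum.elim x 0) = 0 := by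
    rw [← h.dotProduct_mulVec_zero_iff]
    simp [borderedMatrix, Matrix.fromBlocks_mulVec, hx, dotProduct]
  have := congrFun h0 (Sum.inr 0)
  simpa [borderedMatrix, Matrix.fromBlocks_mulVec, Matrix.mulVec, dotProduct] using this

theorem borderedMatrix_conjTranspose_mul_self {ι : Type*} [Fintype ι] [DecidableEq ι]
    (C : Matrix ι ι ℂ) (w : ι → ℂ) (d : ℝ) :
    borderedMatrix (C.conjTranspose * C) (C.conjTranspose.mulVec w) d =
      star (Matrix.fromBlocks C 0 0 (1 : Matrix (Fin 1) (Fin 1) ℂ)) * borderedMatrix 1 w d *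
        Matrix.fromBlocks C 0 0 1 := by
  simp [borderedMatrix, Matrix.star_eq_conjTranspose, Matrix.fromBlocks_conjTranspose,
    Matrix.fromBlocks_multiply, Matrix.replicateCol_mulVec, Matrix.conjTranspose_mul]

theorem det_borderedMatrix_one {ι : Type*} [Fintype ι] [DecidableEq ι] (w : ι → ℂ) (d : ℝ) :
    (borderedMatrix 1 w d).det = ((d - ∑ i, ‖w i‖ ^ 2 : ℝ) : ℂ) := by
  simp [borderedMatrix, Matrix.det_fromBlocks_one₁₁, Matrix.mul_apply, Complex.conj_mul']

theorem posSemidef_borderedMatrix_one {ι : Type*} [Fintype ι] [DecidableEq ι] (w : ι → ℂ)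
    (d : ℝ) : (borderedMatrix 1 w d).PosSemidef ↔ ∑ i, ‖w i‖ ^ 2 ≤ d := by
  have : Invertible (1 : Matrix ι ι ℂ) := invertibleOne
  have hsub : (Matrix.of fun _ _ => (d : ℂ)) - (Matrix.replicateCol (Fin 1) w).conjTranspose *
      (1 : Matrix ι ι ℂ)⁻¹ * Matrix.replicateCol (Fin 1) w =
      Matrix.diagonal fun _ => ((d - ∑ i, ‖w i‖ ^ 2 : ℝ) : ℂ) := by
    ext i j
    simp [Subsingleton.elim i j, Matrix.mul_apply, Complex.conj_mul']
  rw [borderedMatrix, Matrix.PosDef.fromBlocks₁₁ _ _ Matrix.PosDef.one, hsub,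
    Matrix.posSemidef_diagonal_iff]
  simp only [Complex.zero_le_real, sub_nonneg, forall_const]

theorem detPowWeight_borderedMatrix_conjTranspose_mul_self {ι : Type*} [Fintype ι]
    [DecidableEq ι] (s : ℕ) {C : Matrix ι ι ℂ} (hC : C.det ≠ 0) (w : ι → ℂ) (d : ℝ) :
    detPowWeight s (borderedMatrix (C.conjTranspose * C) (C.conjTranspose.mulVec w) d) =
      ENNReal.ofReal (Complex.normSq C.det ^ s) *
        {v : ι → ℂ | ∑ i, ‖v i‖ ^ 2 ≤ d}.indicator
          (fun v => ENNReal.ofReal ((d - ∑ i, ‖v i‖ ^ 2) ^ s)) w := by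
  have hU : IsUnit (Matrix.fromBlocks C 0 0 (1 : Matrix (Fin 1) (Fin 1) ℂ)) := by
    rw [Matrix.isUnit_iff_isUnit_det]
    simpa using hC
  have hdet : (star (Matrix.fromBlocks C 0 0 (1 : Matrix (Fin 1) (Fin 1) ℂ)) *
      borderedMatrix 1 w d * Matrix.fromBlocks C 0 0 1).det =
      ((Complex.normSq C.det * (d - ∑ i, ‖w i‖ ^ 2) : ℝ) : ℂ) := by
    rw [Matrix.det_mul, Matrix.det_mul, det_borderedMatrix_one, Matrix.star_eq_conjTranspose,
      Matrix.det_conjTranspose]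
    simp only [Matrix.det_fromBlocks_zero₂₁, Matrix.det_one, mul_one, Complex.ofReal_mul,
      Complex.normSq_eq_conj_mul_self, starRingEnd_apply]
    ring
  rw [borderedMatrix_conjTranspose_mul_self]
  by_cases hw : ∑ i, ‖w i‖ ^ 2 ≤ d
  · rw [detPowWeight_of_posSemidef, Set.indicator_of_mem (by exact hw), hdet, Complex.ofReal_re,
      mul_pow, ENNReal.ofReal_mul (pow_nonneg (Complex.normSq_nonneg _) _)]
    rw [Matrix.IsUnit.posSemidef_star_left_conjugate_iff hU]
    exact (posSemidef_borderedMatrix_one w d).2 hw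
  · rw [detPowWeight_of_not_posSemidef, Set.indicator_of_notMem (by exact hw), mul_zero]
    rw [Matrix.IsUnit.posSemidef_star_left_conjugate_iff hU]
    exact fun h => hw ((posSemidef_borderedMatrix_one w d).1 h)

theorem lintegral_detPowWeight_borderedMatrix_of_posDef {ι : Type*} [Fintype ι] [DecidableEq ι]
    (s : ℕ) {A : Matrix ι ι ℂ} (hA : A.PosDef) {d : ℝ} (hd : 0 ≤ d) :
    ∫⁻ v, detPowWeight s (borderedMatrix A v d) =
      ENNReal.ofReal (Real.pi ^ Fintype.card ι * s.factorial * d ^ (Fintype.card ι + s) /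
        (Fintype.card ι + s).factorial) * detPowWeight (s + 1) A := by
  obtain ⟨C, hC⟩ : ∃ C : Matrix ι ι ℂ, A = C.conjTranspose * C := by
    open scoped MatrixOrder in
    exact CStarAlgebra.nonneg_iff_eq_star_mul_self.mp hA.posSemidef.nonneg
  have hdetA : A.det = ((Complex.normSq C.det : ℝ) : ℂ) := by
    rw [hC, Matrix.det_mul, Matrix.det_conjTranspose, Complex.normSq_eq_conj_mul_self,
      starRingEnd_apply]
  have hCdet : C.det ≠ 0 := by
    have := hA.posSemidef.posDef_iff_det_ne_zero.1 hA
    rw [hdetA] at this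
    exact fun h => this (by simp [h])
  have hmeas : Measurable ({v : ι → ℂ | ∑ i, ‖v i‖ ^ 2 ≤ d}.indicator
      (fun v => ENNReal.ofReal ((d - ∑ i, ‖v i‖ ^ 2) ^ s))) :=
    Measurable.indicator (by fun_prop)
      (isClosed_le (by fun_prop) continuous_const).measurableSet
  rw [lintegral_comp_mulVec C.conjTranspose
    (by rw [Matrix.det_conjTranspose]; exact star_ne_zero.2 hCdet) _
    (measurable_detPowWeight_comp s
      (continuous_borderedMatrix (v := fun v => v) continuous_const continuous_id d))]
  rw [detPowWeight_of_posSemidef _ hA.posSemidef, hdetA, Complex.ofReal_re, hC]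
  simp_rw [detPowWeight_borderedMatrix_conjTranspose_mul_self s hCdet]
  rw [lintegral_const_mul _ hmeas, lintegral_ball_sub_sum_norm_sq_pow ι s hd, ← mul_assoc,
    ← ENNReal.ofReal_mul (Complex.normSq_nonneg _), mul_comm]
  congr 2
  rw [Matrix.det_conjTranspose, ← starRingEnd_apply, Complex.normSq_conj, pow_succ']

theorem lintegral_detPowWeight_borderedMatrix_of_not_posDef {ι : Type*} [Fintype ι]
    [DecidableEq ι] (s : ℕ) {A : Matrix ι ι ℂ} (hA : ¬ A.PosDef) (d : ℝ) :
    ∫⁻ v, detPowWeight s (borderedMatrix A v d) = 0 := by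
  by_cases hA' : A.PosSemidef
  · have hdet : A.det = 0 := by
      by_contra h
      exact hA (hA'.posDef_iff_det_ne_zero.2 h)
    obtain ⟨x, hx0, hx⟩ := Matrix.exists_mulVec_eq_zero_iff.2 hdet
    let φ : (ι → ℂ) →ₗ[ℝ] ℂ := (Fintype.linearCombination ℂ (star x)).restrictScalars ℝ
    have hφ : ∀ v, φ v = ∑ i, v i * star (x i) := fun v => by
      simp [φ, Fintype.linearCombination_apply]
    have hnull : volume ((LinearMap.ker φ : Submodule ℝ (ι → ℂ)) : Set (ι → ℂ)) = 0 := by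
      refine Measure.addHaar_submodule _ _ fun htop => hx0 ?_
      have : φ x = 0 := by
        rw [← LinearMap.mem_ker, htop]
        trivial
      rw [hφ] at this
      exact dotProduct_self_star_eq_zero.1 this
    refine (lintegral_congr_ae ?_).trans lintegral_zero
    filter_upwards [measure_eq_zero_iff_ae_notMem.1 hnull] with v hv
    refine detPowWeight_of_not_posSemidef s fun h => hv ?_
    have := congrArg star (dotProduct_eq_zero_of_borderedMatrix h hx)
    rw [SetLike.mem_coe, LinearMap.mem_ker, hφ]
    simpa [dotProduct, mul_comm] using this
  · refine (lintegral_congr fun v => ?_).trans lintegral_zero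
    exact detPowWeight_of_not_posSemidef s fun h => hA' (posSemidef_of_borderedMatrix h)

/-- Integrating out the last column of a positive semidefinite matrix. -/
theorem lintegral_detPowWeight_borderedMatrix {n : ℕ} (s : ℕ) (A : Matrix (Fin n) (Fin n) ℂ)
    {d : ℝ} (hd : 0 ≤ d) :
    ∫⁻ v, detPowWeight s (borderedMatrix A v d) =
      ENNReal.ofReal (Real.pi ^ n * s.factorial * d ^ (n + s) / (n + s).factorial) *
        detPowWeight (s + 1) A := by
  by_cases hA : A.PosDef
  · simpa using lintegral_detPowWeight_borderedMatrix_of_posDef s hA hd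
  · rw [lintegral_detPowWeight_borderedMatrix_of_not_posDef s hA]
    by_cases hA' : A.PosSemidef
    · have hdet : A.det = 0 := by
        by_contra h
        exact hA (hA'.posDef_iff_det_ne_zero.2 h)
      simp [detPowWeight_of_posSemidef _ hA', hdet]
    · rw [detPowWeight_of_not_posSemidef _ hA', mul_zero]

/-- The strictly upper triangular positions of an `(n + 1) × (n + 1)` matrix are those of its
leading `n × n` block together with those of the last column. -/
noncomputable def upperPairsSucc (n : ℕ) :
    {p : Fin n × Fin n // p.1 < p.2} ⊕ Fin n ≃ {p : Fin (n + 1) × Fin (n + 1) // p.1 < p.2} :=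
  Equiv.ofBijective
    (Sum.elim (fun p => ⟨(p.1.1.castSucc, p.1.2.castSucc), Fin.castSucc_lt_castSucc_iff.2 p.2⟩)
      fun i => ⟨(i.castSucc, Fin.last n), Fin.castSucc_lt_last i⟩) <| by
    constructor
    · rintro (⟨⟨i, j⟩, hij⟩ | i) (⟨⟨k, l⟩, hkl⟩ | k) h <;>
        simp_all [Fin.ext_iff] <;> grind
    · rintro ⟨⟨i, j⟩, hij⟩
      obtain ⟨i, rfl⟩ := Fin.exists_castSucc_eq.2 (hij.trans_le (Fin.le_last j)).ne
      induction j using Fin.lastCases with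
      | last => exact ⟨Sum.inr i, rfl⟩
      | cast j => exact ⟨Sum.inl ⟨(i, j), Fin.castSucc_lt_castSucc_iff.1 hij⟩, rfl⟩

/-- Splitting off the last column from the strictly upper triangular entries. -/
noncomputable def upperEntriesSucc (n : ℕ) :
    ({p : Fin n × Fin n // p.1 < p.2} → ℂ) × (Fin n → ℂ) ≃ᵐ
      ({p : Fin (n + 1) × Fin (n + 1) // p.1 < p.2} → ℂ) :=
  (MeasurableEquiv.sumPiEquivProdPi fun _ => ℂ).symm.trans
    (MeasurableEquiv.piCongrLeft (fun _ => ℂ) (upperPairsSucc n))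

theorem measurePreserving_upperEntriesSucc (n : ℕ) :
    MeasurePreserving (upperEntriesSucc n) volume volume :=
  (volume_measurePreserving_piCongrLeft (fun _ => ℂ) (upperPairsSucc n)).comp
    (volume_measurePreserving_sumPiEquivProdPi_symm fun _ => ℂ)

theorem upperEntriesSucc_apply_castSucc {n : ℕ}
    (q : ({p : Fin n × Fin n // p.1 < p.2} → ℂ) × (Fin n → ℂ)) {i j : Fin n} (hij : i < j) :
    upperEntriesSucc n q ⟨(i.castSucc, j.castSucc), Fin.castSucc_lt_castSucc_iff.2 hij⟩ =
      q.1 ⟨(i, j), hij⟩ :=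
  Equiv.piCongrLeft_apply_apply (fun _ => ℂ) (upperPairsSucc n) _ (Sum.inl ⟨(i, j), hij⟩)

theorem upperEntriesSucc_apply_last {n : ℕ}
    (q : ({p : Fin n × Fin n // p.1 < p.2} → ℂ) × (Fin n → ℂ)) (i : Fin n) :
    upperEntriesSucc n q ⟨(i.castSucc, Fin.last n), Fin.castSucc_lt_last i⟩ = q.2 i :=
  Equiv.piCongrLeft_apply_apply (fun _ => ℂ) (upperPairsSucc n) _ (Sum.inr i)

theorem hermOfUpper_submatrix_finSumFinEquiv {n : ℕ} (d : Fin (n + 1) → ℝ)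
    (q : ({p : Fin n × Fin n // p.1 < p.2} → ℂ) × (Fin n → ℂ)) :
    (hermOfUpper (n + 1) d (upperEntriesSucc n q)).submatrix finSumFinEquiv finSumFinEquiv =
      borderedMatrix (hermOfUpper n (fun i => d i.castSucc) q.1) q.2 (d (Fin.last n)) := by
  have hlast : ∀ k : Fin 1, Fin.natAdd n k = Fin.last n := fun k => by
    rw [Subsingleton.elim k 0]; rfl
  have hcast : ∀ i : Fin n, Fin.castAdd 1 i = i.castSucc := fun i => rfl
  ext (i | i) (j | j)
  · rcases lt_trichotomy i j with h | rfl | h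
    · simp [borderedMatrix, hermOfUpper, hcast, h, upperEntriesSucc_apply_castSucc]
    · simp [borderedMatrix, hermOfUpper, hcast]
    · simp [borderedMatrix, hermOfUpper, hcast, h, h.not_gt, upperEntriesSucc_apply_castSucc]
  · simp [borderedMatrix, hermOfUpper, hcast, hlast, Fin.castSucc_lt_last,
      upperEntriesSucc_apply_last]
  · simp [borderedMatrix, hermOfUpper, hcast, hlast, Fin.castSucc_lt_last,
      (Fin.castSucc_lt_last _).not_gt, upperEntriesSucc_apply_last]
  · simp [borderedMatrix, hermOfUpper, hlast]

theorem continuous_hermOfUpper (n : ℕ) (d : Fin n → ℝ) : Continuous (hermOfUpper n d) := by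
  refine continuous_matrix fun i j => ?_
  unfold hermOfUpper
  split_ifs
  · exact continuous_apply _
  · exact Complex.continuous_conj.comp (continuous_apply _)
  · exact continuous_const

theorem lintegral_detPowWeight_hermOfUpper_succ (n s : ℕ) {d : Fin (n + 1) → ℝ}
    (hd : ∀ i, 0 ≤ d i) :
    ∫⁻ u, detPowWeight s (hermOfUpper (n + 1) d u) =
      ENNReal.ofReal (Real.pi ^ n * s.factorial * d (Fin.last n) ^ (n + s) /
          (n + s).factorial) *
        ∫⁻ u, detPowWeight (s + 1) (hermOfUpper n (fun i => d i.castSucc) u) := by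
  have hfun : ∀ q, detPowWeight s (hermOfUpper (n + 1) d (upperEntriesSucc n q)) =
      detPowWeight s (borderedMatrix (hermOfUpper n (fun i => d i.castSucc) q.1) q.2
        (d (Fin.last n))) := fun q => by
    rw [← hermOfUpper_submatrix_finSumFinEquiv, detPowWeight_submatrix_equiv]
  have hcont := continuous_hermOfUpper n fun i => d i.castSucc
  rw [← (measurePreserving_upperEntriesSucc n).lintegral_comp_emb
    (upperEntriesSucc n).measurableEmbedding]
  simp_rw [hfun]
  rw [Measure.volume_eq_prod, lintegral_prod]
  · simp_rw [lintegral_detPowWeight_borderedMatrix s _ (hd (Fin.last n))]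
    exact lintegral_const_mul _ (measurable_detPowWeight_comp _ hcont)
  · exact (measurable_detPowWeight_comp s (continuous_borderedMatrix (hcont.comp continuous_fst)
      continuous_snd _)).aemeasurable

theorem lintegral_detPowWeight_hermOfUpper (n s : ℕ) {d : Fin n → ℝ} (hd : ∀ i, 0 ≤ d i) :
    ∫⁻ u, detPowWeight s (hermOfUpper n d u) =
      ENNReal.ofReal (Real.pi ^ (n * (n - 1) / 2) * ((n + s - 1).factorial : ℝ)⁻¹ ^ n *
        (∏ k ∈ Finset.range n, ((s + k).factorial : ℝ)) * ∏ j, d j ^ (n + s - 1)) := by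
  induction n generalizing s with
  | zero =>
    have : ∀ u, detPowWeight s (hermOfUpper 0 d u) = 1 := fun u => by
      have hM : hermOfUpper 0 d u = 1 := Subsingleton.elim _ _
      rw [hM, detPowWeight_of_posSemidef s Matrix.PosSemidef.one]
      simp
    simp [this, volume_pi]
  | succ n ih =>
    rw [lintegral_detPowWeight_hermOfUpper_succ n s hd, ih (s + 1) fun i => hd _,
      ← ENNReal.ofReal_mul (by have := hd (Fin.last n); positivity)]
    congr 1
    have h1 : n + (s + 1) - 1 = n + s := by omega
    have h2 : n + 1 + s - 1 = n + s := by omega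
    have h3 : (n + 1) * (n + 1 - 1) / 2 = n + n * (n - 1) / 2 := by
      rw [← Finset.sum_range_id, ← Finset.sum_range_id, Finset.sum_range_succ, add_comm]
    rw [h1, h2, h3, Fin.prod_univ_castSucc, Finset.prod_range_succ', pow_add, pow_succ]
    simp only [add_zero, add_assoc, add_comm 1]
    ring

theorem hermOfUpper_neg (n : ℕ) (h : Fin n → ℝ) (u : {p : Fin n × Fin n // p.1 < p.2} → ℂ) :
    hermOfUpper n (fun i => -h i) (-u) = -hermOfUpper n h u := by
  ext i j
  simp only [hermOfUpper, Matrix.neg_apply]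
  split_ifs <;> simp

theorem integral_posSemidef_det_pow (n s : ℕ) {d : Fin n → ℝ} (hd : ∀ i, 0 ≤ d i) :
    (∫ u in {u : {p : Fin n × Fin n // p.1 < p.2} → ℂ | (hermOfUpper n d u).PosSemidef},
      ((hermOfUpper n d u).det.re ^ s)) =
      Real.pi ^ (n * (n - 1) / 2) * ((n + s - 1).factorial : ℝ)⁻¹ ^ n *
        (∏ k ∈ Finset.range n, ((s + k).factorial : ℝ)) * ∏ j, d j ^ (n + s - 1) := by
  have hcont := continuous_hermOfUpper n d
  have hS : MeasurableSet {u | (hermOfUpper n d u).PosSemidef} :=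
    (isClosed_setOf_posSemidef.preimage hcont).measurableSet
  have hc : Continuous fun u => (hermOfUpper n d u).det.re ^ s :=
    (Complex.continuous_re.comp hcont.matrix_det).pow s
  rw [integral_eq_lintegral_of_nonneg_ae _ hc.aestronglyMeasurable,
    ← lintegral_indicator hS]
  · rw [← ENNReal.toReal_ofReal (r := _ * ∏ j, d j ^ (n + s - 1)),
      ← lintegral_detPowWeight_hermOfUpper n s hd]
    · rfl
    · have : 0 ≤ ∏ j, d j ^ (n + s - 1) := Finset.prod_nonneg fun j _ => pow_nonneg (hd j) _
      positivity
  · filter_upwards [ae_restrict_mem hS] with u hu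
    exact pow_nonneg (Complex.nonneg_iff.1 (Matrix.PosSemidef.det_nonneg hu)).1 s

/-- **Integral over negative semidefinite Hermitian matrices** (Proposition A.2 of
Liu–Zhang): for `r₀ ≥ n` and fixed nonpositive diagonal entries `h j`, the integral of
`(det H)^(r₀ - n)` over all strictly upper triangular entries making `H` negative
semidefinite equals
`π^(n(n-1)/2) ((r₀-1)!)⁻ⁿ (∏_{k=1}^n (r₀-k)!) ∏_j h_j^(r₀-1)`. -/
theorem integral_negSemidef_det_pow (n r₀ : ℕ) (hn : 1 ≤ n) (hr : n ≤ r₀)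
    (h : Fin n → ℝ) (hneg : ∀ j, h j ≤ 0) :
    (∫ u in {u : {p : Fin n × Fin n // p.1 < p.2} → ℂ |
        (-(hermOfUpper n h u)).PosSemidef},
      ((hermOfUpper n h u).det) ^ (r₀ - n)) =
    ((Real.pi : ℂ) ^ (n * (n - 1) / 2)) * (((r₀ - 1).factorial : ℂ))⁻¹ ^ n *
      (∏ k ∈ Finset.Icc 1 n, ((r₀ - k).factorial : ℂ)) *
      ∏ j, ((h j : ℂ)) ^ (r₀ - 1) := by
  obtain ⟨s, rfl⟩ := Nat.exists_eq_add_of_le hr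
  have hd : ∀ i, 0 ≤ -h i := fun i => neg_nonneg.2 (hneg i)
  have hS : MeasurableSet {u | (hermOfUpper n (fun i => -h i) u).PosSemidef} :=
    (isClosed_setOf_posSemidef.preimage (continuous_hermOfUpper n _)).measurableSet
  have hS' : MeasurableSet {u | (-(hermOfUpper n h u)).PosSemidef} :=
    (isClosed_setOf_posSemidef.preimage (continuous_hermOfUpper n h).neg).measurableSet
  have hpt : ∀ u, {u | (-(hermOfUpper n h u)).PosSemidef}.indicator
      (fun u => (hermOfUpper n h u).det ^ (n + s - n)) u =
      (-1 : ℂ) ^ (n * s) * {u | (hermOfUpper n (fun i => -h i) u).PosSemidef}.indicator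
        (fun u => (((hermOfUpper n (fun i => -h i) u).det.re ^ s : ℝ) : ℂ)) (-u) := by
    intro u
    by_cases hu : (-(hermOfUpper n h u)).PosSemidef
    · have hdet := Matrix.PosSemidef.det_nonneg hu
      have hre : (((-(hermOfUpper n h u)).det.re : ℝ) : ℂ) = (-(hermOfUpper n h u)).det :=
        Complex.ext rfl (Complex.nonneg_iff.1 hdet).2
      rw [Set.indicator_of_mem (by exact hu),
        Set.indicator_of_mem (by rwa [Set.mem_ofPred_eq, hermOfUpper_neg]), hermOfUpper_neg,
        Complex.ofReal_pow, hre, Matrix.det_neg, Fintype.card_fin, Nat.add_sub_cancel_left,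
        mul_pow, ← pow_mul, ← mul_assoc, ← mul_pow]
      norm_num
    · rw [Set.indicator_of_notMem (by exact hu),
        Set.indicator_of_notMem (by rwa [Set.mem_ofPred_eq, hermOfUpper_neg]), mul_zero]
  rw [← integral_indicator hS']
  simp_rw [hpt]
  rw [integral_const_mul, integral_neg_eq_self
    ({u | (hermOfUpper n (fun i => -h i) u).PosSemidef}.indicator
      fun u => (((hermOfUpper n (fun i => -h i) u).det.re ^ s : ℝ) : ℂ)) volume,
    integral_indicator hS, integral_complex_ofReal, integral_posSemidef_det_pow n s hd]
  have hfact : ∏ k ∈ Finset.Icc 1 n, ((n + s - k).factorial : ℂ) =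
      ∏ k ∈ Finset.range n, ((s + k).factorial : ℂ) := by
    refine Finset.prod_bij' (fun k _ => n - k) (fun k _ => n - k) ?_ ?_ ?_ ?_ ?_ <;>
      intro k hk <;> simp only [Finset.mem_Icc, Finset.mem_range] at * <;> try omega
    congr 2
    omega
  have hsign : (-1 : ℂ) ^ (n * s) * ((-1) ^ (n + s - 1)) ^ n = 1 := by
    rw [← pow_mul, ← pow_add, Even.neg_one_pow]
    have h1 : n * s + (n + s - 1) * n = n * (n - 1) + 2 * (n * s) := by
      obtain ⟨m, rfl⟩ := Nat.exists_eq_add_of_le' hn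
      have h2 : m + 1 + s - 1 = m + s := by omega
      have h3 : m + 1 - 1 = m := by omega
      rw [h2, h3]
      ring
    rw [h1]
    exact (Nat.even_mul_pred_self n).add (even_two_mul _)
  have hprod : ∏ j, ((-h j : ℝ) : ℂ) ^ (n + s - 1) =
      ((-1) ^ (n + s - 1)) ^ n * ∏ j, (h j : ℂ) ^ (n + s - 1) := by
    simp_rw [Complex.ofReal_neg, neg_pow (h _ : ℂ) (n + s - 1), Finset.prod_mul_distrib]
    simp
  rw [hfact]
  push_cast at hprod ⊢
  rw [hprod]
  linear_combination (Real.pi : ℂ) ^ (n * (n - 1) / 2) * ((n + s - 1).factorial : ℂ)⁻¹ ^ n *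
    (∏ k ∈ Finset.range n, ((s + k).factorial : ℂ)) *
    (∏ j, (h j : ℂ) ^ (n + s - 1)) * hsign
end

section
/- For every real number z, the limit as n tends to −1 from above of (1/(√(2π) Γ(n+1))) ∫₀^∞ vⁿ e^{−(v+z)²/2} dv equals (1/√(2π)) e^{−z²/2}. In other words, with IE_n(z) = (1/(√(2π) Γ(n+1))) ∫₀^∞ vⁿ e^{−(v+z)²/2} dv for n > −1, one has lim_{n→−1⁺} IE_n(z) = (1/√(2π)) e^{−z²/2}. -/
open MeasureTheory

/-- The repeated erfc integral `IE_n(z)` of Liu–Zhang, for a real parameter `n > -1`. -/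
noncomputable def IE (n : ℝ) (z : ℝ) : ℝ :=
  (1 / (Real.sqrt (2 * Real.pi) * Real.Gamma (n + 1))) *
    ∫ v in Set.Ioi (0 : ℝ), v ^ n * Real.exp (-(v + z) ^ 2 / 2)

theorem abs_exp_sub_exp_le (a b : ℝ) :
    |Real.exp a - Real.exp b| ≤ |a - b| * (Real.exp a + Real.exp b) := by
  wlog h : b ≤ a generalizing a b
  · rw [abs_sub_comm, abs_sub_comm a, add_comm]
    exact this b a (le_of_not_ge h)
  rw [abs_of_nonneg (by simpa using h), abs_of_nonneg (by simpa using h)]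
  have h1 : (b - a + 1) * Real.exp a ≤ Real.exp b := by
    calc (b - a + 1) * Real.exp a ≤ Real.exp (b - a) * Real.exp a := by
          gcongr
          exact Real.add_one_le_exp _
      _ = Real.exp b := by rw [← Real.exp_add]; simp
  nlinarith [mul_nonneg (sub_nonneg.2 h) (Real.exp_pos b).le]

theorem exp_neg_add_sq_le (v z : ℝ) :
    Real.exp (-(v + z) ^ 2 / 2) ≤ Real.exp (1 / 2 - z) * Real.exp (-v) := by
  rw [← Real.exp_add]
  gcongr
  nlinarith [sq_nonneg (v + z - 1)]

theorem abs_exp_neg_add_sq_sub_le {v : ℝ} (hv : 0 < v) (z : ℝ) :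
    |Real.exp (-(v + z) ^ 2 / 2) - Real.exp (-z ^ 2 / 2) * Real.exp (-v)| ≤
      (Real.exp (1 / 2 - z) + 1) * (v * (1 + |z| + v)) * Real.exp (-v) := by
  rw [← Real.exp_add]
  refine (abs_exp_sub_exp_le _ _).trans ?_
  have h1 : |-(v + z) ^ 2 / 2 - (-z ^ 2 / 2 + -v)| ≤ v * (1 + |z| + v) := by
    have : -(v + z) ^ 2 / 2 - (-z ^ 2 / 2 + -v) = v * (1 - z - v / 2) := by ring
    rw [this, abs_mul, abs_of_pos hv]
    gcongr
    rw [abs_le]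
    constructor <;> linarith [neg_abs_le z, le_abs_self z]
  have h2 : Real.exp (-z ^ 2 / 2 + -v) ≤ Real.exp (-v) := by
    gcongr
    nlinarith [sq_nonneg z]
  calc _ ≤ v * (1 + |z| + v) * (Real.exp (1 / 2 - z) * Real.exp (-v) + Real.exp (-v)) := by
        gcongr
        exact exp_neg_add_sq_le v z
    _ = _ := by ring

theorem integrableOn_rpow_mul_exp_neg {n : ℝ} (hn : -1 < n) :
    IntegrableOn (fun v : ℝ => v ^ n * Real.exp (-v)) (Set.Ioi 0) := by
  simpa [mul_comm] using Real.GammaIntegral_convergent (s := n + 1) (by linarith)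

theorem integral_rpow_mul_exp_neg {n : ℝ} (hn : -1 < n) :
    ∫ v in Set.Ioi (0 : ℝ), v ^ n * Real.exp (-v) = Real.Gamma (n + 1) := by
  rw [Real.Gamma_eq_integral (by linarith)]
  simp [mul_comm]

theorem integrableOn_rpow_mul_exp_neg_add_sq {n : ℝ} (hn : -1 < n) (z : ℝ) :
    IntegrableOn (fun v : ℝ => v ^ n * Real.exp (-(v + z) ^ 2 / 2)) (Set.Ioi 0) := by
  refine Integrable.mono' ((integrableOn_rpow_mul_exp_neg hn).const_mul (Real.exp (1 / 2 - z)))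
    (by fun_prop) ?_
  refine (ae_restrict_iff' measurableSet_Ioi).2 (.of_forall fun v hv => ?_)
  have hv : 0 < v := hv
  rw [Real.norm_of_nonneg (by positivity)]
  calc _ ≤ v ^ n * (Real.exp (1 / 2 - z) * Real.exp (-v)) := by
        gcongr
        exact exp_neg_add_sq_le v z
    _ = _ := by ring

theorem abs_integral_sub_le {n : ℝ} (hn : -1 < n) (z : ℝ) :
    |(∫ v in Set.Ioi (0 : ℝ), v ^ n * Real.exp (-(v + z) ^ 2 / 2)) -
        Real.exp (-z ^ 2 / 2) * Real.Gamma (n + 1)| ≤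
      (Real.exp (1 / 2 - z) + 1) * ((n + 1) * (1 + |z| + (n + 2))) * Real.Gamma (n + 1) := by
  have hi1 := integrableOn_rpow_mul_exp_neg (n := n + 1) (by linarith)
  have hi2 := integrableOn_rpow_mul_exp_neg (n := n + 2) (by linarith)
  have hG1 : Real.Gamma (n + 1 + 1) = (n + 1) * Real.Gamma (n + 1) :=
    Real.Gamma_add_one (by linarith)
  have hG2 : Real.Gamma (n + 2 + 1) = (n + 2) * ((n + 1) * Real.Gamma (n + 1)) := by
    rw [Real.Gamma_add_one (by linarith), ← hG1]
    ring_nf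
  rw [← integral_rpow_mul_exp_neg hn, ← integral_const_mul,
    ← integral_sub (integrableOn_rpow_mul_exp_neg_add_sq hn z)
      ((integrableOn_rpow_mul_exp_neg hn).const_mul _), integral_rpow_mul_exp_neg hn]
  have hb : ∫ v in Set.Ioi (0 : ℝ), (Real.exp (1 / 2 - z) + 1) *
      ((1 + |z|) * (v ^ (n + 1) * Real.exp (-v)) + v ^ (n + 2) * Real.exp (-v)) =
      (Real.exp (1 / 2 - z) + 1) * ((n + 1) * (1 + |z| + (n + 2))) * Real.Gamma (n + 1) := by
    rw [integral_const_mul, integral_add (hi1.const_mul _) hi2, integral_const_mul,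
      integral_rpow_mul_exp_neg (by linarith), integral_rpow_mul_exp_neg (by linarith), hG1, hG2]
    ring
  rw [← hb, ← Real.norm_eq_abs]
  refine norm_integral_le_of_norm_le (((hi1.const_mul _).add hi2).const_mul _) ?_
  refine (ae_restrict_iff' measurableSet_Ioi).2 (.of_forall fun v hv => ?_)
  have hv : 0 < v := hv
  have hp2 : v ^ (n + 2) = v ^ n * v ^ 2 := by exact_mod_cast Real.rpow_add_natCast hv.ne' n 2
  calc _ = v ^ n *
        |Real.exp (-(v + z) ^ 2 / 2) - Real.exp (-z ^ 2 / 2) * Real.exp (-v)| := by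
        rw [← abs_of_pos (Real.rpow_pos_of_pos hv n), ← abs_mul, Real.norm_eq_abs,
          abs_of_pos (Real.rpow_pos_of_pos hv n)]
        ring_nf
    _ ≤ v ^ n * ((Real.exp (1 / 2 - z) + 1) * (v * (1 + |z| + v)) * Real.exp (-v)) := by
        gcongr
        exact abs_exp_neg_add_sq_sub_le hv z
    _ = _ := by
        rw [Real.rpow_add_one hv.ne', hp2]
        ring

theorem abs_IE_sub_le {n : ℝ} (hn : -1 < n) (z : ℝ) :
    |IE n z - 1 / Real.sqrt (2 * Real.pi) * Real.exp (-z ^ 2 / 2)| ≤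
      1 / Real.sqrt (2 * Real.pi) *
        ((Real.exp (1 / 2 - z) + 1) * ((n + 1) * (1 + |z| + (n + 2)))) := by
  have hG : 0 < Real.Gamma (n + 1) := Real.Gamma_pos_of_pos (by linarith)
  have hs : 0 < Real.sqrt (2 * Real.pi) := by positivity
  have h : IE n z - 1 / Real.sqrt (2 * Real.pi) * Real.exp (-z ^ 2 / 2) =
      1 / (Real.sqrt (2 * Real.pi) * Real.Gamma (n + 1)) *
        ((∫ v in Set.Ioi (0 : ℝ), v ^ n * Real.exp (-(v + z) ^ 2 / 2)) -
          Real.exp (-z ^ 2 / 2) * Real.Gamma (n + 1)) := by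
    rw [IE]
    field_simp
  rw [h, abs_mul, abs_of_pos (by positivity)]
  refine (mul_le_mul_of_nonneg_left (abs_integral_sub_le hn z) (by positivity)).trans_eq ?_
  field_simp

/-- **The limit `IE_{-1}(z)`**: as `n → -1⁺`, `IE_n(z) → (1/√(2π)) e^{-z²/2}`. -/
theorem IE_tendsto_neg_one (z : ℝ) :
    Filter.Tendsto (fun n : ℝ => IE n z) (nhdsWithin (-1) (Set.Ioi (-1)))
      (nhds ((1 / Real.sqrt (2 * Real.pi)) * Real.exp (-z ^ 2 / 2))) := by
  rw [tendsto_iff_norm_sub_tendsto_zero]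
  have hlim : Filter.Tendsto (fun n : ℝ => 1 / Real.sqrt (2 * Real.pi) *
      ((Real.exp (1 / 2 - z) + 1) * ((n + 1) * (1 + |z| + (n + 2)))))
      (nhdsWithin (-1) (Set.Ioi (-1))) (nhds 0) := by
    refine tendsto_nhdsWithin_of_tendsto_nhds (Continuous.tendsto' (by fun_prop) _ _ ?_)
    simp
  refine squeeze_zero' (.of_forall fun _ => norm_nonneg _) ?_ hlim
  filter_upwards [self_mem_nhdsWithin] with n hn
  exact abs_IE_sub_le hn z
end
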